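/- arXiv:2211.12367 — 7 statements merged into one kernel-verified Lean document; each statement's English description precedes it below -/
import Mathlib

section
/- Let G be a finite additive abelian group of odd order g and let H be a subgroup of G of order h. Then there exists a strong frame starter in G∖H if and only if there exists an adder for the patterned frame starter in G∖H. -/
/-- The family `f`, indexed by `Fin m ⊕ Fin m`, hits each element of `G \\ H`
exactly once. -/
def CoversComplement {G : Type*} [AddCommGroup G] (H : AddSubgroup G) {m : ℕ}
    (f : Fin m ⊕ Fin m → G) : Prop :=
  Function.Injective f ∧ Set.range f = {z : G | z ∉ H}

/-- The pairs `{x i, y i}` form a frame starter in `G \\ H`: the entries hit each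
element of `G \\ H` exactly once, and so do the differences `±(x i - y i)`. -/
def IsFrameStarter {G : Type*} [AddCommGroup G] (H : AddSubgroup G) {m : ℕ}
    (x y : Fin m → G) : Prop :=
  CoversComplement H (Sum.elim x y) ∧
    CoversComplement H (Sum.elim (fun i => x i - y i) (fun i => y i - x i))

/-- A frame starter is strong if the sums `x i + y i` avoid `H` and are pairwise
distinct. -/
def IsStrongFS {G : Type*} [AddCommGroup G] (H : AddSubgroup G) {m : ℕ}
    (x y : Fin m → G) : Prop :=
  (∀ i, x i + y i ∉ H) ∧ Function.Injective fun i => x i + y i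

/-- A frame starter is skew if the sums `±(x i + y i)` hit each element of
`G \\ H` exactly once. -/
def IsSkewFS {G : Type*} [AddCommGroup G] (H : AddSubgroup G) {m : ℕ}
    (x y : Fin m → G) : Prop :=
  CoversComplement H (Sum.elim (fun i => x i + y i) (fun i => -(x i + y i)))

/-- `a` is an adder for the frame starter `(x, y)`: the `a i` are pairwise distinct
elements of `G \\ H` and the translated pairs `{x i + a i, y i + a i}` again form
a frame starter in `G \\ H`. -/
def IsAdder {G : Type*} [AddCommGroup G] (H : AddSubgroup G) {m : ℕ}
    (x y a : Fin m → G) : Prop :=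
  (∀ i, a i ∉ H) ∧ Function.Injective a ∧
    IsFrameStarter H (fun i => x i + a i) (fun i => y i + a i)

/-- A finite abelian group of odd order admits halving by an integer multiple. -/
theorem exists_nsmul_two_nsmul_eq {G : Type*} [AddCommGroup G] [Fintype G]
    (hodd : Odd (Fintype.card G)) : ∃ k : ℕ, ∀ z : G, k • (2 • z) = z := by
  obtain ⟨n, hn⟩ := hodd
  refine ⟨n + 1, fun z => ?_⟩
  rw [← mul_nsmul', show (n + 1) * 2 = Fintype.card G + 1 by omega, add_nsmul,
    card_nsmul_eq_zero, zero_add, one_nsmul]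

/-- Multiplication by `k`, when inverse to doubling, preserves coverings of `G \\ H`. -/
theorem CoversComplement.nsmul {G : Type*} [AddCommGroup G] {H : AddSubgroup G} {m k : ℕ}
    {f : Fin m ⊕ Fin m → G} (hf : CoversComplement H f) (hk : ∀ z : G, k • (2 • z) = z) :
    CoversComplement H (fun s => k • f s) := by
  have hk' : ∀ z : G, 2 • (k • z) = z := fun z => by rw [nsmul_left_comm, hk]
  refine ⟨fun s t hst => hf.1 ?_, Set.ext fun z => ?_⟩
  · rw [← hk' (f s), ← hk' (f t)]
    exact congrArg (2 • ·) hst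
  · have hz : 2 • z ∈ Set.range f ↔ 2 • z ∉ H := by rw [hf.2]; rfl
    have hH : 2 • z ∈ H ↔ z ∈ H :=
      ⟨fun h => hk z ▸ H.nsmul_mem h k, fun h => H.nsmul_mem h 2⟩
    rw [Set.mem_ofPred_eq, ← hH, ← hz]
    constructor
    · rintro ⟨s, rfl⟩
      exact ⟨s, (hk' _).symm⟩
    · rintro ⟨s, hs⟩
      exact ⟨s, by simp only [hs, hk]⟩

/-- For a finite abelian group `G` of odd order and a subgroup `H`,
there exists a strong frame starter in `G \\ H` iff there exists an adder for the
patterned frame starter in `G \\ H`. -/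
theorem stmt0 (G : Type*) [AddCommGroup G] [Fintype G]
    (hodd : Odd (Fintype.card G)) (H : AddSubgroup G) :
    (∃ (m : ℕ) (x y : Fin m → G), IsFrameStarter H x y ∧ IsStrongFS H x y) ↔
      (∃ (m : ℕ) (x : Fin m → G), IsFrameStarter H x (fun i => -x i) ∧
        ∃ a : Fin m → G, IsAdder H x (fun i => -x i) a) := by
  obtain ⟨k, hk⟩ := exists_nsmul_two_nsmul_eq hodd
  have hk' : ∀ z : G, 2 • (k • z) = z := fun z => by rw [nsmul_left_comm, hk]
  constructor
  · rintro ⟨m, x, y, hxy, hsum, hinj⟩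
    have hx : ∀ i, k • (x i - y i) + k • (x i + y i) = x i := fun i => by
      rw [← nsmul_add, show x i - y i + (x i + y i) = 2 • x i by abel, hk]
    have hy : ∀ i, -(k • (x i - y i)) + k • (x i + y i) = y i := fun i => by
      rw [← smul_neg, ← nsmul_add, show -(x i - y i) + (x i + y i) = 2 • y i by abel, hk]
    refine ⟨m, fun i => k • (x i - y i), ⟨?_, ?_⟩, fun i => k • (x i + y i),
      fun i hi => hsum i ?_, fun i j hij => hinj ?_, ?_⟩
    · convert hxy.2.nsmul hk using 1
      ext (i | i) <;> simp [← smul_neg]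
    · convert hxy.2 using 1
      ext (i | i)
      · simp only [Sum.elim_inl, sub_neg_eq_add, ← two_nsmul, hk']
      · simp only [Sum.elim_inr, ← neg_add', ← two_nsmul, hk', neg_sub]
    · rw [← hk' (x i + y i)]
      exact H.nsmul_mem hi 2
    · change x i + y i = x j + y j
      rw [← hk' (x i + y i), ← hk' (x j + y j)]
      exact congrArg (2 • ·) hij
    · simpa only [hx, hy] using hxy
  · rintro ⟨m, x, -, a, haH, hainj, hxa⟩
    have hsum : ∀ i, x i + a i + (-x i + a i) = 2 • a i := fun i => by abel
    refine ⟨m, _, _, hxa, fun i hi => haH i ?_, fun i j hij => hainj ?_⟩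
    · rw [← hk (a i), ← hsum]
      exact H.nsmul_mem hi k
    · simp only [hsum] at hij
      rw [← hk (a i), ← hk (a j), hij]
end

section
/- Let G be a finite additive abelian group of odd order g and let H be a subgroup of G of order h. Then there exists a skew frame starter in G∖H if and only if there exists a skew adder for the patterned frame starter in G∖H. -/
/-- The adder `a` is skew: the values `±(a i)` hit each element of `G \\ H`
exactly once. -/
def IsSkewAdder {G : Type*} [AddCommGroup G] (H : AddSubgroup G) {m : ℕ}
    (a : Fin m → G) : Prop :=
  CoversComplement H (Sum.elim a (fun i => -a i))

/-- In a finite abelian group of odd order, some natural number acts as the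
inverse of doubling. -/
theorem exists_half {G : Type*} [AddCommGroup G] [Fintype G]
    (hodd : Odd (Fintype.card G)) :
    ∃ n : ℕ, (∀ z : G, n • z + n • z = z) ∧ ∀ z : G, n • (z + z) = z := by
  obtain ⟨k, hk⟩ := hodd
  have key : ∀ z : G, (k + 1) • z + (k + 1) • z = z := fun z => by
    have hz : (2 * k + 1) • z = 0 := hk ▸ card_nsmul_eq_zero
    rw [← add_nsmul, show k + 1 + (k + 1) = 2 * k + 1 + 1 by ring, succ_nsmul, hz, zero_add]
  exact ⟨k + 1, key, fun z => by rw [nsmul_add, key]⟩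

/-- In a finite abelian group of odd order, doubling a family does not change whether it
covers the complement of a subgroup exactly once. -/
theorem coversComplement_add_self_iff {G : Type*} [AddCommGroup G] [Fintype G]
    (hodd : Odd (Fintype.card G)) (H : AddSubgroup G) {m : ℕ} (f : Fin m ⊕ Fin m → G) :
    CoversComplement H (fun s => f s + f s) ↔ CoversComplement H f := by
  obtain ⟨n, hn, hn'⟩ := exists_half (G := G) hodd
  have hinj : Function.Injective fun z : G => z + z := fun a b h => by
    rw [← hn' a, ← hn' b]
    exact congrArg (n • ·) h
  have hmem : ∀ z : G, z + z ∈ H ↔ z ∈ H := fun z =>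
    ⟨fun h => hn' z ▸ H.nsmul_mem h n, fun h => H.add_mem h h⟩
  refine and_congr (hinj.of_comp_iff f) ?_
  simp only [Set.ext_iff, Set.mem_range, Set.mem_ofPred_eq]
  constructor
  · intro h z
    rw [← hmem z, ← h (z + z)]
    exact exists_congr fun s => hinj.eq_iff.symm
  · intro h z
    rw [← hn z, hmem, ← h (n • z)]
    exact exists_congr fun s => hinj.eq_iff

/-- For a finite abelian group `G` of odd order and a subgroup `H`,
there exists a skew frame starter in `G \\ H` iff there exists a skew adder for
the patterned frame starter in `G \\ H`. -/
theorem stmt1 (G : Type*) [AddCommGroup G] [Fintype G]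
    (hodd : Odd (Fintype.card G)) (H : AddSubgroup G) :
    (∃ (m : ℕ) (x y : Fin m → G), IsFrameStarter H x y ∧ IsSkewFS H x y) ↔
      (∃ (m : ℕ) (x : Fin m → G), IsFrameStarter H x (fun i => -x i) ∧
        ∃ a : Fin m → G, IsAdder H x (fun i => -x i) a ∧ IsSkewAdder H a) := by
  constructor
  · rintro ⟨m, x, y, hxy, hskew⟩
    obtain ⟨n, hn, -⟩ := exists_half (G := G) hodd
    have hx : ∀ i, n • (x i - y i) + n • (x i + y i) = x i := fun i => by
      rw [← nsmul_add, show x i - y i + (x i + y i) = x i + x i by abel, nsmul_add, hn]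
    have hy : ∀ i, -(n • (x i - y i)) + n • (x i + y i) = y i := fun i => by
      rw [← neg_nsmul, ← nsmul_add, show -(x i - y i) + (x i + y i) = y i + y i by abel,
        nsmul_add, hn]
    have ha : CoversComplement H
        (Sum.elim (fun i => n • (x i + y i)) fun i => -(n • (x i + y i))) := by
      rw [← coversComplement_add_self_iff hodd]
      unfold IsSkewFS at hskew
      convert hskew using 1
      funext s
      rcases s with i | i <;> simp only [Sum.elim_inl, Sum.elim_inr, ← neg_add, hn]
    refine ⟨m, fun i => n • (x i - y i), ⟨?_, ?_⟩, fun i => n • (x i + y i), ⟨?_, ?_, ?_⟩, ha⟩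
    · rw [← coversComplement_add_self_iff hodd]
      convert hxy.2 using 1
      funext s
      rcases s with i | i <;> simp only [Sum.elim_inl, Sum.elim_inr, ← neg_add, hn, neg_sub]
    · convert hxy.2 using 2
      · funext i
        rw [sub_neg_eq_add, hn]
      · funext i
        rw [sub_eq_add_neg, ← neg_add, hn, neg_sub]
    · exact fun i => ha.2.subset ⟨Sum.inl i, rfl⟩
    · exact ha.1.comp Sum.inl_injective
    · simpa only [hx, hy] using hxy
  · rintro ⟨m, x, -, a, ⟨-, -, hfs⟩, ha⟩
    refine ⟨m, _, _, hfs, ?_⟩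
    rw [IsSkewAdder, ← coversComplement_add_self_iff hodd] at ha
    unfold IsSkewFS
    convert ha using 1
    funext s
    rcases s with i | i <;> simp only [Sum.elim_inl, Sum.elim_inr] <;> abel
end

section
/- If n > 5 is a prime number, then there exists a skew starter in Z_n (the cyclic group of integers modulo n). -/
section Reduction

variable {n : ℕ} [NeZero n]

/-- A family indexed by `Fin m ⊕ Fin m` that reaches every nonzero element of `ZMod n`, with
`2 * m ≤ n - 1`, reaches each of them exactly once. -/
lemma coversComplement_bot_of_forall_exists {m : ℕ} (hm : 2 * m + 1 ≤ n)
    (f : Fin m ⊕ Fin m → ZMod n) (hf : ∀ z, z ≠ 0 → ∃ i, f i = z) :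
    CoversComplement (⊥ : AddSubgroup (ZMod n)) f := by
  classical
  have hsub : (Finset.univ.erase (0 : ZMod n)) ⊆ Finset.univ.image f := by
    intro z hz
    obtain ⟨i, hi⟩ := hf z (Finset.ne_of_mem_erase hz)
    exact Finset.mem_image.2 ⟨i, Finset.mem_univ _, hi⟩
  have hcard : (Finset.univ.erase (0 : ZMod n)).card = n - 1 := by
    rw [Finset.card_erase_of_mem (Finset.mem_univ _), Finset.card_univ, ZMod.card]
  have hdom : (Finset.univ : Finset (Fin m ⊕ Fin m)).card = 2 * m := by
    simp [Finset.card_univ, two_mul]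
  have hle : (Finset.univ.image f).card ≤ (Finset.univ : Finset (Fin m ⊕ Fin m)).card :=
    Finset.card_image_le
  have heq : Finset.univ.erase (0 : ZMod n) = Finset.univ.image f :=
    Finset.eq_of_subset_of_card_le hsub (by omega)
  have hge := Finset.card_le_card hsub
  refine ⟨by simpa using Finset.card_image_iff.1 (le_antisymm hle (by omega)), ?_⟩
  ext z
  simpa using (Finset.ext_iff.1 heq z).symm

/-- A family of at most `(n - 1) / 2` pairs in `ZMod n` whose entries, signed differences and
signed sums all reach every nonzero element is a skew starter. -/
lemma exists_skew_starter_of_forall_exists {ι : Type*} [Fintype ι]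
    (hcard : 2 * Fintype.card ι + 1 ≤ n) (x y : ι → ZMod n)
    (hentry : ∀ z, z ≠ 0 → ∃ i, x i = z ∨ y i = z)
    (hdiff : ∀ z, z ≠ 0 → ∃ i, x i - y i = z ∨ x i - y i = -z)
    (hsum : ∀ z, z ≠ 0 → ∃ i, x i + y i = z ∨ x i + y i = -z) :
    ∃ (m : ℕ) (x y : Fin m → ZMod n),
      IsFrameStarter (⊥ : AddSubgroup (ZMod n)) x y ∧
        IsSkewFS (⊥ : AddSubgroup (ZMod n)) x y := by
  let σ := Fintype.equivFin ι
  refine ⟨Fintype.card ι, x ∘ σ.symm, y ∘ σ.symm, ⟨?_, ?_⟩, ?_⟩ <;>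
    refine coversComplement_bot_of_forall_exists hcard _ fun z hz => ?_
  · obtain ⟨i, h | h⟩ := hentry z hz
    · exact ⟨Sum.inl (σ i), by simp [h]⟩
    · exact ⟨Sum.inr (σ i), by simp [h]⟩
  · obtain ⟨i, h | h⟩ := hdiff z hz
    · exact ⟨Sum.inl (σ i), by simp [h]⟩
    · exact ⟨Sum.inr (σ i), by simp [← neg_sub (x i), h]⟩
  · obtain ⟨i, h | h⟩ := hsum z hz
    · exact ⟨Sum.inl (σ i), by simp [h]⟩
    · exact ⟨Sum.inr (σ i), by
        simp only [Sum.elim_inr, Function.comp_apply, Equiv.symm_apply_apply, h, neg_neg]⟩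

end Reduction

section OddRootOfUnity

variable {p : ℕ} [Fact p.Prime]

/-- The pairs `{x, -h x}`, where `h ≠ 1` is a root of unity of odd order `q` and `x` runs over the
elements for which `x ^ q` lies in a fixed half-system modulo `±1`, form a skew starter. -/
lemma exists_skew_starter_of_odd_root (hp2 : p ≠ 2) {q : ℕ} (hq : Odd q) {h : ZMod p}
    (hh : h ^ q = 1) (h1 : h ≠ 1) :
    ∃ (m : ℕ) (x y : Fin m → ZMod p),
      IsFrameStarter (⊥ : AddSubgroup (ZMod p)) x y ∧
        IsSkewFS (⊥ : AddSubgroup (ZMod p)) x y := by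
  classical
  have hp : p.Prime := Fact.out
  have hneg : (-1 : ZMod p) ≠ 1 := by
    have : Fact (2 < p) := ⟨lt_of_le_of_ne hp.two_le (Ne.symm hp2)⟩
    exact ZMod.neg_one_ne_one
  have hm1 : h ≠ -1 := by
    rintro rfl
    exact hneg (by rwa [hq.neg_one_pow] at hh)
  have h0 : h ≠ 0 := by
    rintro rfl
    rw [zero_pow hq.pos.ne'] at hh
    exact zero_ne_one hh
  have hadd : 1 + h ≠ 0 := fun e => hm1 (by linear_combination e)
  have hsub : 1 - h ≠ 0 := fun e => h1 (by linear_combination -e)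
  let X : Finset (ZMod p) := Finset.univ.filter fun x => (x ^ q).val < ((-x) ^ q).val
  have hmem : ∀ x, x ∈ X ↔ (x ^ q).val < ((-x) ^ q).val := fun x => by simp [X]
  have hX0 : (0 : ZMod p) ∉ X := by simp [hmem]
  have hdisj : ∀ x ∈ X, -x ∉ X := fun x hx hx' => by
    rw [hmem] at hx hx'
    rw [neg_neg] at hx'
    exact lt_asymm hx hx'
  have hhalf : ∀ z : ZMod p, z ≠ 0 → z ∈ X ∨ -z ∈ X := fun z hz => by
    rw [hmem, hmem, neg_neg]
    refine lt_or_gt_of_ne fun e => ?_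
    have e' := ZMod.val_injective p e
    rw [hq.neg_pow] at e'
    have : z ^ q * (-1 - 1) = 0 := by linear_combination -e'
    rcases mul_eq_zero.1 this with e | e
    · exact hz (pow_eq_zero_iff hq.pos.ne' |>.1 e)
    · exact hneg (sub_eq_zero.1 e)
  have hcard : 2 * Fintype.card X + 1 ≤ p := by
    have hd : Disjoint X (X.image Neg.neg) := by
      refine Finset.disjoint_left.2 fun x hx hx' => ?_
      obtain ⟨w, hw, rfl⟩ := Finset.mem_image.1 hx'
      exact hdisj w hw hx
    have hs : X ∪ X.image Neg.neg ⊆ Finset.univ.erase 0 := by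
      intro x hx
      refine Finset.mem_erase.2 ⟨?_, Finset.mem_univ _⟩
      rintro rfl
      simp [hX0] at hx
    have := Finset.card_le_card hs
    rw [Finset.card_union_of_disjoint hd, Finset.card_image_of_injective _ neg_injective,
      Finset.card_erase_of_mem (Finset.mem_univ _), Finset.card_univ, ZMod.card] at this
    rw [Fintype.card_coe]
    have := hp.pos
    omega
  have hscale : ∀ c : ZMod p, c ≠ 0 → ∀ z, z ≠ 0 → ∃ i : X, c * i = z ∨ c * i = -z := by
    intro c hc z hz
    rcases hhalf (c⁻¹ * z) (mul_ne_zero (inv_ne_zero hc) hz) with hx | hx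
    · exact ⟨⟨_, hx⟩, Or.inl (by simp [hc])⟩
    · exact ⟨⟨_, hx⟩, Or.inr (by simp [hc])⟩
  refine exists_skew_starter_of_forall_exists hcard (fun i => (i : ZMod p))
    (fun i => -(h * i)) ?_ ?_ ?_
  · intro z hz
    rcases hhalf z hz with hx | hx
    · exact ⟨⟨z, hx⟩, Or.inl rfl⟩
    · refine ⟨⟨-(h⁻¹ * z), ?_⟩, Or.inr (by simp [h0])⟩
      rw [hmem] at hx ⊢
      rwa [← mul_neg, ← mul_neg, mul_pow, mul_pow, inv_pow, hh, inv_one, one_mul, one_mul]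
  · intro z hz
    obtain ⟨i, hi⟩ := hscale _ hadd z hz
    refine ⟨i, ?_⟩
    rwa [sub_neg_eq_add, show (i : ZMod p) + h * i = (1 + h) * i by ring]
  · intro z hz
    obtain ⟨i, hi⟩ := hscale _ hsub z hz
    refine ⟨i, ?_⟩
    rwa [show (i : ZMod p) + -(h * i) = (1 - h) * i by ring]

end OddRootOfUnity

section Pinwheel

/-- Labels `(e, a, b)` of the sixteen blocks of side `t` tiling the nonzero residues modulo
`16 * t ^ 2 + 1`. -/
abbrev PinwheelBlock := Fin 4 × Fin 2 × Fin 2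

/-- The point at offset `w` of a block: with `r = 4 * t`, a square root of `-1`, this is
`r ^ e * ((1 + a * t) + (b * t) * r + w)`. -/
def PinwheelBlock.point {R : Type*} [CommRing R] (t w : R) (l : PinwheelBlock) : R :=
  (4 * t) ^ (l.1 : ℕ) *
    (1 + (l.2.1 : ℕ) * t + (l.2.2 : ℕ) * t * (4 * t) + w)

/-- Blocks containing the first entries of the eight families of pairs. -/
def fstBlock : Fin 8 → PinwheelBlock :=
  ![(0, 0, 0), (0, 1, 0), (0, 1, 1), (1, 1, 0), (1, 0, 1), (1, 1, 1), (3, 1, 0), (3, 1, 1)]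

/-- Blocks containing the second entries of the eight families of pairs. -/
def sndBlock : Fin 8 → PinwheelBlock :=
  ![(1, 0, 0), (3, 0, 1), (3, 0, 0), (2, 0, 1), (0, 0, 1), (2, 0, 0), (2, 1, 0), (2, 1, 1)]

/-- Blocks containing the differences of the eight families, divided by `1 - 4 * t`. -/
def diffBlock : Fin 8 → PinwheelBlock :=
  ![(0, 0, 0), (1, 0, 0), (1, 1, 0), (1, 1, 1), (2, 0, 1), (1, 0, 1), (0, 1, 0), (0, 1, 1)]

/-- Blocks containing the sums of the eight families, divided by `1 - 4 * t`. -/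
def sumBlock : Fin 8 → PinwheelBlock :=
  ![(1, 0, 0), (0, 1, 1), (0, 0, 1), (2, 0, 0), (1, 0, 1), (2, 1, 0), (3, 1, 0), (3, 1, 1)]

variable {R : Type*} [CommRing R] {t : R}

lemma PinwheelBlock.point_add_two (ht : 16 * t ^ 2 = -1) (w : R) (l : PinwheelBlock) :
    PinwheelBlock.point t w (l.1 + 2, l.2) = -l.point t w := by
  obtain ⟨e, a, b⟩ := l
  fin_cases e <;> simp [PinwheelBlock.point] <;> grind

lemma point_fstBlock_sub_point_sndBlock (ht : 16 * t ^ 2 = -1) (w : R) (k : Fin 8) :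
    (fstBlock k).point t w - (sndBlock k).point t w = (1 - 4 * t) * (diffBlock k).point t w := by
  fin_cases k <;> simp [PinwheelBlock.point, fstBlock, sndBlock, diffBlock] <;> grind

lemma point_fstBlock_add_point_sndBlock (ht : 16 * t ^ 2 = -1) (w : R) (k : Fin 8) :
    (fstBlock k).point t w + (sndBlock k).point t w = (1 - 4 * t) * (sumBlock k).point t w := by
  fin_cases k <;> simp [PinwheelBlock.point, fstBlock, sndBlock, sumBlock] <;> grind

lemma exists_fstBlock_or_sndBlock (l : PinwheelBlock) :
    ∃ k, fstBlock k = l ∨ sndBlock k = l := by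
  revert l; decide

lemma exists_diffBlock (l : PinwheelBlock) :
    ∃ k, diffBlock k = l ∨ diffBlock k = (l.1 + 2, l.2) := by
  revert l; decide

lemma exists_sumBlock (l : PinwheelBlock) :
    ∃ k, sumBlock k = l ∨ sumBlock k = (l.1 + 2, l.2) := by
  revert l; decide

/-- The sixteen blocks of side `t` cover the nonzero residues modulo `16 * t ^ 2 + 1`. -/
lemma exists_point_eq (t : ℕ) (z : ZMod (16 * t ^ 2 + 1)) (hz : z ≠ 0) :
    ∃ (l : PinwheelBlock) (i j : Fin t),
      l.point (t : ZMod (16 * t ^ 2 + 1)) ((i : ℕ) + (j : ℕ) * (4 * t)) = z := by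
  have ht : 16 * (t : ZMod (16 * t ^ 2 + 1)) ^ 2 = -1 := by
    have := ZMod.natCast_self (16 * t ^ 2 + 1)
    push_cast at this
    linear_combination this
  have hsplit : ∀ s < 2 * t, ∃ (a : Fin 2) (i : Fin t), s = a * t + i := by
    intro s hs
    rcases lt_or_ge s t with h | h
    · exact ⟨0, ⟨s, h⟩, by simp⟩
    · exact ⟨1, ⟨s - t, by omega⟩, by simp; omega⟩
  have hblock : ∀ (e : Fin 4) (a b : ℕ), a < 2 * t → b < 2 * t →
      ∃ (l : PinwheelBlock) (i j : Fin t),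
        l.point (t : ZMod (16 * t ^ 2 + 1)) ((i : ℕ) + (j : ℕ) * (4 * t)) =
          (4 * t) ^ (e : ℕ) * (a + 1 + b * (4 * t)) := by
    intro e a b ha hb
    obtain ⟨A, i, rfl⟩ := hsplit a ha
    obtain ⟨B, j, rfl⟩ := hsplit b hb
    refine ⟨(e, A, B), i, j, ?_⟩
    simp only [PinwheelBlock.point]
    push_cast
    ring
  have hsmall : ∀ v : ℕ, v < 8 * t ^ 2 → ∃ (l : PinwheelBlock) (i j : Fin t),
      l.point (t : ZMod (16 * t ^ 2 + 1)) ((i : ℕ) + (j : ℕ) * (4 * t)) = (v + 1 : ℕ) := by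
    intro v hv
    have htpos : 0 < 4 * t := by
      rcases Nat.eq_zero_or_pos t with rfl | h
      · simp at hv
      · omega
    have hdiv : v / (4 * t) < 2 * t := by
      rw [Nat.div_lt_iff_lt_mul htpos]
      nlinarith
    have hmod := Nat.mod_lt v htpos
    have hv' := Nat.div_add_mod v (4 * t)
    generalize v / (4 * t) = b at hdiv hv'
    generalize v % (4 * t) = a at hmod hv'
    subst hv'
    rcases lt_or_ge a (2 * t) with ha | ha
    · obtain ⟨l, i, j, h⟩ := hblock 0 a b ha hdiv
      refine ⟨l, i, j, h.trans ?_⟩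
      simp only [Fin.val_zero, pow_zero]
      push_cast
      ring
    · obtain ⟨c, hc⟩ : ∃ c, a + c + 1 = 4 * t := ⟨4 * t - a - 1, by omega⟩
      obtain ⟨l, i, j, h⟩ := hblock 1 b c hdiv (by omega)
      refine ⟨l, i, j, h.trans ?_⟩
      have hc' : (a : ZMod (16 * t ^ 2 + 1)) + c + 1 = 4 * t := by
        simpa using congrArg (Nat.cast : ℕ → ZMod (16 * t ^ 2 + 1)) hc
      simp only [Fin.val_one, pow_one]
      push_cast
      linear_combination (c : ZMod (16 * t ^ 2 + 1)) * ht - hc'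
  have hval : ((z.val : ℕ) : ZMod (16 * t ^ 2 + 1)) = z := ZMod.natCast_zmod_val z
  have hlt := ZMod.val_lt z
  have hpos : 0 < z.val := Nat.pos_of_ne_zero fun h => hz ((ZMod.val_eq_zero z).1 h)
  rcases le_or_gt z.val (8 * t ^ 2) with h | h
  · obtain ⟨l, i, j, e⟩ := hsmall (z.val - 1) (by omega)
    exact ⟨l, i, j, by rw [e, Nat.sub_add_cancel hpos, hval]⟩
  · obtain ⟨l, i, j, e⟩ := hsmall (16 * t ^ 2 - z.val) (by omega)
    refine ⟨(l.1 + 2, l.2), i, j, ?_⟩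
    rw [PinwheelBlock.point_add_two ht, e,
      show 16 * t ^ 2 - z.val + 1 = 16 * t ^ 2 + 1 - z.val by omega, Nat.cast_sub hlt.le,
      ZMod.natCast_self, hval]
    ring

/-- There is a skew starter modulo every number of the form `16 * t ^ 2 + 1`. -/
lemma exists_skew_starter_sixteen_mul_sq_add_one (t : ℕ) :
    ∃ (m : ℕ) (x y : Fin m → ZMod (16 * t ^ 2 + 1)),
      IsFrameStarter (⊥ : AddSubgroup (ZMod (16 * t ^ 2 + 1))) x y ∧
        IsSkewFS (⊥ : AddSubgroup (ZMod (16 * t ^ 2 + 1))) x y := by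
  set n := 16 * t ^ 2 + 1 with hn
  have ht : 16 * (t : ZMod n) ^ 2 = -1 := by
    have := ZMod.natCast_self n
    rw [hn] at this
    push_cast at this
    linear_combination this
  let w : Fin t × Fin t → ZMod n := fun q => (q.1 : ℕ) + (q.2 : ℕ) * (4 * t)
  have hunit : (1 - 4 * (t : ZMod n)) * ((1 + 4 * t) * (1 + 8 * t ^ 2)) = 1 := by
    linear_combination (-8 * (t : ZMod n) ^ 2) * ht
  have hcover : ∀ B : Fin 8 → PinwheelBlock,
      (∀ l : PinwheelBlock, ∃ k, B k = l ∨ B k = (l.1 + 2, l.2)) → ∀ z : ZMod n, z ≠ 0 →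
      ∃ i : Fin 8 × Fin t × Fin t, (1 - 4 * (t : ZMod n)) * (B i.1).point (t : ZMod n) (w i.2) = z ∨
        (1 - 4 * (t : ZMod n)) * (B i.1).point (t : ZMod n) (w i.2) = -z := by
    intro B hB z hz
    have hz' : (1 + 4 * (t : ZMod n)) * (1 + 8 * t ^ 2) * z ≠ 0 := fun e =>
      hz (by linear_combination (1 - 4 * (t : ZMod n)) * e - z * hunit)
    obtain ⟨l, i, j, hl⟩ := exists_point_eq t _ hz'
    obtain ⟨k, hk | hk⟩ := hB l
    · refine ⟨(k, i, j), Or.inl ?_⟩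
      simp only [hk, w]
      linear_combination (1 - 4 * (t : ZMod n)) * hl + z * hunit
    · refine ⟨(k, i, j), Or.inr ?_⟩
      simp only [hk, w, PinwheelBlock.point_add_two ht]
      linear_combination -(1 - 4 * (t : ZMod n)) * hl - z * hunit
  refine exists_skew_starter_of_forall_exists (ι := Fin 8 × Fin t × Fin t) ?_
    (fun i => (fstBlock i.1).point (t : ZMod n) (w i.2))
    (fun i => (sndBlock i.1).point (t : ZMod n) (w i.2)) ?_ ?_ ?_
  · simp only [Fintype.card_prod, Fintype.card_fin, hn]
    exact le_of_eq (by ring)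
  · intro z hz
    obtain ⟨l, i, j, hl⟩ := exists_point_eq t z hz
    obtain ⟨k, hk⟩ := exists_fstBlock_or_sndBlock l
    refine ⟨(k, i, j), hk.imp ?_ ?_⟩ <;>
    · intro h
      simpa only [h, w] using hl
  · simpa only [point_fstBlock_sub_point_sndBlock ht] using hcover diffBlock exists_diffBlock
  · simpa only [point_fstBlock_add_point_sndBlock ht] using hcover sumBlock exists_sumBlock

end Pinwheel

/-- A prime `p > 5` either is of the form `16 * t ^ 2 + 1` or has an odd prime `q ∣ p - 1`. -/
lemma Nat.Prime.eq_sixteen_mul_sq_add_one_or_exists_odd_prime_dvd {p : ℕ} (hp : p.Prime)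
    (h5 : 5 < p) : (∃ t, p = 16 * t ^ 2 + 1) ∨ ∃ q, q.Prime ∧ Odd q ∧ q ∣ p - 1 := by
  by_cases hq : ∃ q, q.Prime ∧ Odd q ∧ q ∣ p - 1
  · exact Or.inr hq
  push Not at hq
  have hpow : p - 1 = 2 ^ (p - 1).primeFactorsList.length :=
    Nat.eq_prime_pow_of_unique_prime_dvd (by omega) fun {q} hqp hqd =>
      hqp.eq_two_or_odd'.resolve_right fun ho => hq q hqp ho hqd
  generalize (p - 1).primeFactorsList.length = k at hpow
  have hpk : p = 2 ^ k + 1 := by omega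
  left
  rcases Nat.even_or_odd' k with ⟨j, rfl | rfl⟩
  · rcases lt_or_ge j 2 with hj | hj
    · interval_cases j <;> norm_num at hpk <;> omega
    · obtain ⟨i, rfl⟩ := Nat.exists_eq_add_of_le hj
      exact ⟨2 ^ i, by rw [hpk]; ring⟩
  · exfalso
    have h3 : 3 ∣ p := by
      have := Odd.nat_add_dvd_pow_add_pow 2 1 (n := 2 * j + 1) ⟨j, rfl⟩
      simpa [hpk] using this
    have := (Nat.prime_dvd_prime_iff_eq Nat.prime_three hp).1 h3
    omega

/-- If `n > 5` is prime, then there is a skew starter in `ℤ_n`. -/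
theorem stmt3 (n : ℕ) (hp : n.Prime) (hn : 5 < n) :
    ∃ (m : ℕ) (x y : Fin m → ZMod n),
      IsFrameStarter (⊥ : AddSubgroup (ZMod n)) x y ∧
        IsSkewFS (⊥ : AddSubgroup (ZMod n)) x y := by
  rcases hp.eq_sixteen_mul_sq_add_one_or_exists_odd_prime_dvd hn with ⟨t, rfl⟩ | ⟨q, hq, ho, hd⟩
  · exact exists_skew_starter_sixteen_mul_sq_add_one t
  · have : Fact n.Prime := ⟨hp⟩
    have : Fact q.Prime := ⟨hq⟩
    obtain ⟨u, hu⟩ := exists_prime_orderOf_dvd_card (G := (ZMod n)ˣ) q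
      (by rwa [ZMod.card_units])
    refine exists_skew_starter_of_odd_root (by omega) ho (h := (u : ZMod n)) ?_ ?_
    · rw [← Units.val_pow_eq_pow_val, ← hu, pow_orderOf_eq_one, Units.val_one]
    · intro h
      rw [Units.val_eq_one] at h
      rw [h, orderOf_one] at hu
      exact hq.one_lt.ne hu
end

section
/- If n is a positive integer with gcd(n,30) = 1 and n > 1, then there exists a skew starter in Z_n (the cyclic group of integers modulo n). -/
/-- A family of at most `(n - 1) / 2` pairs in `ℤ_n` whose entries, differences and sums each
reach every nonzero element. By counting, such a family is a skew starter. -/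
def HasSkewCover (n : ℕ) : Prop :=
  ∃ (ι : Type) (_ : Fintype ι) (x y : ι → ZMod n),
    2 * Fintype.card ι + 1 ≤ n ∧
    (∀ z, z ≠ 0 → ∃ j, x j = z ∨ y j = z) ∧
    (∀ z, z ≠ 0 → ∃ j, x j - y j = z ∨ y j - x j = z) ∧
    (∀ z, z ≠ 0 → ∃ j, x j + y j = z ∨ -(x j + y j) = z)

/-- A family of at most `n - 1` elements of `ℤ_n` reaching all nonzero elements reaches each of
them exactly once, and misses `0`. -/
theorem coversComplement_of_surjOn {n m : ℕ} (hm : 2 * m + 1 ≤ n) (f : Fin m ⊕ Fin m → ZMod n)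
    (hf : ∀ z, z ≠ 0 → ∃ j, f j = z) : CoversComplement (⊥ : AddSubgroup (ZMod n)) f := by
  have : NeZero n := ⟨by omega⟩
  have hsub : Finset.univ.erase (0 : ZMod n) ⊆ Finset.univ.image f := by
    intro z hz
    obtain ⟨j, hj⟩ := hf z (Finset.ne_of_mem_erase hz)
    exact Finset.mem_image.2 ⟨j, Finset.mem_univ _, hj⟩
  have hcard : (Finset.univ.erase (0 : ZMod n)).card = n - 1 := by
    rw [Finset.card_erase_of_mem (Finset.mem_univ _), Finset.card_univ, ZMod.card]
  have hdom : (Finset.univ : Finset (Fin m ⊕ Fin m)).card = 2 * m := by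
    simp [two_mul]
  have hle : (Finset.univ.image f).card ≤ 2 * m := hdom ▸ Finset.card_image_le
  have hge := Finset.card_le_card hsub
  have heq := Finset.eq_of_subset_of_card_le hsub (by omega)
  refine ⟨fun i j hij => Finset.card_image_iff.1 (by omega : (Finset.univ.image f).card = _)
    (Finset.mem_coe.2 (Finset.mem_univ i)) (Finset.mem_coe.2 (Finset.mem_univ j)) hij,
    ?_⟩
  ext z
  simpa [eq_comm] using (Finset.ext_iff.1 heq z).symm

theorem HasSkewCover.exists_skew_starter {n : ℕ} (h : HasSkewCover n) :
    ∃ (m : ℕ) (x y : Fin m → ZMod n),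
      IsFrameStarter (⊥ : AddSubgroup (ZMod n)) x y ∧
        IsSkewFS (⊥ : AddSubgroup (ZMod n)) x y := by
  obtain ⟨ι, _, x, y, hcard, he, hd, hs⟩ := h
  let e := Fintype.equivFin ι
  have key (f g : ι → ZMod n) (hfg : ∀ z, z ≠ 0 → ∃ j, f j = z ∨ g j = z) :
      CoversComplement (⊥ : AddSubgroup (ZMod n))
        (Sum.elim (fun i => f (e.symm i)) (fun i => g (e.symm i))) := by
    refine coversComplement_of_surjOn hcard _ fun z hz => ?_
    obtain ⟨j, hj | hj⟩ := hfg z hz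
    · exact ⟨Sum.inl (e j), by simpa using hj⟩
    · exact ⟨Sum.inr (e j), by simpa using hj⟩
  exact ⟨Fintype.card ι, x ∘ e.symm, y ∘ e.symm, ⟨key x y he, key _ _ hd⟩, key _ _ hs⟩

theorem hasSkewCover_one : HasSkewCover 1 :=
  ⟨Empty, inferInstance, Empty.elim, Empty.elim, by simp,
    fun z hz => (hz (Subsingleton.elim _ _)).elim, fun z hz => (hz (Subsingleton.elim _ _)).elim,
    fun z hz => (hz (Subsingleton.elim _ _)).elim⟩

/-- Multiplication by `c` coprime to `b` permutes the fibres of `ℤ_{ab} → ℤ_a`. -/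
theorem exists_fin_add_mul_eq {a b : ℕ} [NeZero b] {c : ℤ} (hc : IsCoprime c (b : ℤ)) {X Z : ℤ}
    (h : (X : ZMod a) = Z) :
    ∃ k : Fin b, ((X + a * (c * (k : ℕ)) : ℤ) : ZMod (a * b)) = Z := by
  obtain ⟨d, hd⟩ := (ZMod.intCast_eq_intCast_iff_dvd_sub _ _ _).1 h
  obtain ⟨u, v, huv⟩ := hc
  have hb : (0 : ℤ) < b := by exact_mod_cast Nat.pos_of_ne_zero (NeZero.ne b)
  have hk0 := Int.emod_nonneg (d * u) hb.ne'
  have hk1 := Int.emod_lt_of_pos (d * u) hb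
  refine ⟨⟨(d * u % b).toNat, by omega⟩, ?_⟩
  rw [ZMod.intCast_eq_intCast_iff_dvd_sub]
  refine ⟨d * v + c * (d * u / b), ?_⟩
  have hm := Int.emod_add_mul_ediv (d * u) b
  simp only [Int.toNat_of_nonneg hk0]
  push_cast
  linear_combination hd - (a : ℤ) * d * huv - a * c * hm

/-- Skew starters in `ℤ_a` and `ℤ_b` combine to one in `ℤ_{ab}`: pairs over the nonzero classes
of `ℤ_a` are spread along the fibres, and the kernel is a copy of `ℤ_b`. -/
theorem HasSkewCover.mul {a b : ℕ} (ha : HasSkewCover a) (hb : HasSkewCover b)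
    (hb6 : Nat.Coprime b 6) : HasSkewCover (a * b) := by
  obtain ⟨ι, _, x, y, hcard, he, hd, hs⟩ := ha
  obtain ⟨κ, _, x', y', hcard', he', hd', hs'⟩ := hb
  have : NeZero a := ⟨by omega⟩
  have : NeZero b := ⟨by omega⟩
  have hc2 : IsCoprime (2 : ℤ) (b : ℤ) := by
    exact_mod_cast Nat.isCoprime_iff_coprime.2 (Nat.Coprime.coprime_dvd_left (by norm_num) hb6.symm)
  have hc3 : IsCoprime (3 : ℤ) (b : ℤ) := by
    exact_mod_cast Nat.isCoprime_iff_coprime.2 (Nat.Coprime.coprime_dvd_left (by norm_num) hb6.symm)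
  have lift {c : ℕ} [NeZero c] (z : ZMod c) : (((z.val : ℤ)) : ZMod c) = z := by simp
  -- Reduce a covering statement to the fibres over nonzero classes and to the kernel.
  have key (f g : ι × Fin b ⊕ κ → ℤ) (f' g' : κ → ZMod b) (F G : ι → ℤ) (c c' : ℤ)
      (hc : IsCoprime c (b : ℤ)) (hc' : IsCoprime c' (b : ℤ))
      (hf : ∀ j k, f (Sum.inl (j, k)) = F j + a * (c * (k : ℕ)))
      (hg : ∀ j k, g (Sum.inl (j, k)) = G j + a * (c' * (k : ℕ)))
      (hf' : ∀ j, ∃ Y : ℤ, f (Sum.inr j) = a * Y ∧ (Y : ZMod b) = f' j)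
      (hg' : ∀ j, ∃ Y : ℤ, g (Sum.inr j) = a * Y ∧ (Y : ZMod b) = g' j)
      (hFG : ∀ z : ZMod a, z ≠ 0 → ∃ j, (F j : ZMod a) = z ∨ (G j : ZMod a) = z)
      (hfg' : ∀ z, z ≠ 0 → ∃ j, f' j = z ∨ g' j = z) (z : ZMod (a * b)) (hz : z ≠ 0) :
      ∃ j, ((f j : ℤ) : ZMod (a * b)) = z ∨ ((g j : ℤ) : ZMod (a * b)) = z := by
    obtain ⟨Z, rfl⟩ := ZMod.intCast_surjective z
    by_cases hZ : (Z : ZMod a) = 0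
    · obtain ⟨W, rfl⟩ := (ZMod.intCast_zmod_eq_zero_iff_dvd Z a).1 hZ
      have hW : (W : ZMod b) ≠ 0 := by
        intro h0
        obtain ⟨V, rfl⟩ := (ZMod.intCast_zmod_eq_zero_iff_dvd W b).1 h0
        apply hz
        rw [ZMod.intCast_zmod_eq_zero_iff_dvd]
        exact ⟨V, by push_cast; ring⟩
      have scale (Y : ℤ) (h : (Y : ZMod b) = W) :
          ((a * Y : ℤ) : ZMod (a * b)) = ((a * W : ℤ) : ZMod (a * b)) := by
        rw [ZMod.intCast_eq_intCast_iff_dvd_sub] at h ⊢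
        obtain ⟨d, hd⟩ := h
        exact ⟨d, by push_cast; linear_combination (a : ℤ) * hd⟩
      obtain ⟨j, hj | hj⟩ := hfg' _ hW
      · obtain ⟨Y, h1, h2⟩ := hf' j
        exact ⟨Sum.inr j, Or.inl (by rw [h1]; exact scale Y (h2.trans hj))⟩
      · obtain ⟨Y, h1, h2⟩ := hg' j
        exact ⟨Sum.inr j, Or.inr (by rw [h1]; exact scale Y (h2.trans hj))⟩
    · obtain ⟨j, hj | hj⟩ := hFG _ hZ
      · obtain ⟨k, hk⟩ := exists_fin_add_mul_eq hc hj
        exact ⟨Sum.inl (j, k), Or.inl (by rw [hf]; exact hk)⟩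
      · obtain ⟨k, hk⟩ := exists_fin_add_mul_eq hc' hj
        exact ⟨Sum.inl (j, k), Or.inr (by rw [hg]; exact hk)⟩
  let X : ι × Fin b ⊕ κ → ℤ :=
    Sum.elim (fun j => (x j.1).val + a * (j.2 : ℕ)) (fun j => a * (x' j).val)
  let Y : ι × Fin b ⊕ κ → ℤ :=
    Sum.elim (fun j => (y j.1).val + a * (2 * (j.2 : ℕ))) (fun j => a * (y' j).val)
  refine ⟨ι × Fin b ⊕ κ, inferInstance, fun j => X j, fun j => Y j, ?_, ?_, ?_, ?_⟩
  · simp only [Fintype.card_sum, Fintype.card_prod, Fintype.card_fin]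
    nlinarith [Nat.mul_le_mul_right b hcard]
  · refine key X Y x' y' (fun j => (x j).val) (fun j => (y j).val) 1 2 isCoprime_one_left hc2
      (fun j k => by simp [X]) (fun j k => by simp [Y]) (fun j => ⟨(x' j).val, rfl, lift _⟩)
      (fun j => ⟨(y' j).val, rfl, lift _⟩) ?_ he'
    simpa only [lift] using he
  · have := key (fun j => X j - Y j) (fun j => Y j - X j) (fun j => x' j - y' j)
      (fun j => y' j - x' j) (fun j => (x j).val - (y j).val) (fun j => (y j).val - (x j).val)
      (-1) 1 isCoprime_one_left.neg_left isCoprime_one_left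
      (fun j k => by simp [X, Y]; ring) (fun j k => by simp [X, Y]; ring)
      (fun j => ⟨(x' j).val - (y' j).val, by simp [X, Y]; ring, by simp⟩)
      (fun j => ⟨(y' j).val - (x' j).val, by simp [X, Y]; ring, by simp⟩) (by simpa using hd) hd'
    simpa only [Int.cast_sub] using this
  · have := key (fun j => X j + Y j) (fun j => -(X j + Y j)) (fun j => x' j + y' j)
      (fun j => -(x' j + y' j)) (fun j => (x j).val + (y j).val)
      (fun j => -((x j).val + (y j).val))
      3 (-3) hc3 hc3.neg_left
      (fun j k => by simp [X, Y]; ring) (fun j k => by simp [X, Y]; ring)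
      (fun j => ⟨(x' j).val + (y' j).val, by simp [X, Y]; ring, by simp⟩)
      (fun j => ⟨-((x' j).val + (y' j).val), by simp [X, Y]; ring, by simp⟩)
      (by simpa using hs) hs'
    simpa only [Int.cast_add, Int.cast_neg] using this

/-- The pairs `{x, -ux}`, where `u ≠ 1` has odd order `q` and `x` runs over a half-system
invariant under `u`. -/
theorem hasSkewCover_of_odd_prime_dvd {p q : ℕ} (hp : p.Prime) (hq : q.Prime) (hq2 : q ≠ 2)
    (hqp : q ∣ p - 1) : HasSkewCover p := by
  have := Fact.mk hp
  have := Fact.mk hq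
  have hodd : Odd q := hq.odd_of_ne_two hq2
  have hp2 : p ≠ 2 := by
    rintro rfl
    exact hq.one_lt.ne' (Nat.dvd_one.1 hqp)
  have hneg {z : ZMod p} (hz : z ≠ 0) : -z ≠ z := by
    have : Fact (2 < p) := ⟨lt_of_le_of_ne hp.two_le hp2.symm⟩
    exact fun h => hz ((ZMod.neg_eq_self_iff z).1 h |>.resolve_right fun h2 => by
      have := (hp.eq_one_or_self_of_dvd 2 ⟨_, h2.symm⟩); omega)
  obtain ⟨v, hv⟩ := exists_prime_orderOf_dvd_card (G := (ZMod p)ˣ) q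
    (by rwa [ZMod.card_units_eq_totient, Nat.totient_prime hp])
  set u := (v : ZMod p) with hu
  have hu0 : u ≠ 0 := v.ne_zero
  have huq : u ^ q = 1 := by
    rw [hu, ← Units.val_pow_eq_pow_val, ← hv, pow_orderOf_eq_one, Units.val_one]
  have hu1 : 1 - u ≠ 0 := by
    intro h
    have : v = 1 := Units.ext (sub_eq_zero.1 h).symm
    rw [this, orderOf_one] at hv
    exact hq.one_lt.ne hv
  have hu2 : 1 + u ≠ 0 := by
    intro h
    rw [← neg_eq_of_add_eq_zero_right h, hodd.neg_one_pow] at huq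
    exact hneg one_ne_zero huq
  let S : Finset (ZMod p) :=
    Finset.univ.filter fun z => (z ^ q).val < ((-z) ^ q).val
  have memS (z : ZMod p) : z ∈ S ↔ (z ^ q).val < ((-z) ^ q).val := by simp [S]
  have memS_or {z : ZMod p} (hz : z ≠ 0) : z ∈ S ∨ -z ∈ S := by
    rw [memS, memS, neg_neg]
    refine lt_or_gt_of_ne fun h => ?_
    have h' := ZMod.val_injective p h
    rw [hodd.neg_pow] at h'
    exact hneg (pow_ne_zero q hz) h'.symm
  have memS_mul (z : ZMod p) : z * u ∈ S ↔ z ∈ S := by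
    rw [memS, memS, ← neg_mul, mul_pow, mul_pow, huq, mul_one, mul_one]
  have cover {c z : ZMod p} (hc : c ≠ 0) (hz : z ≠ 0) :
      ∃ j : S, (j : ZMod p) * c = z ∨ -((j : ZMod p) * c) = z := by
    rcases memS_or (div_ne_zero hz hc) with h | h
    · exact ⟨⟨_, h⟩, Or.inl (div_mul_cancel₀ z hc)⟩
    · exact ⟨⟨_, h⟩, Or.inr (by simp [hc])⟩
  refine ⟨S, inferInstance, fun j => j, fun j => -(j * u), ?_, ?_, ?_, ?_⟩
  · have hdisj : Disjoint S (S.map (Equiv.neg (ZMod p)).toEmbedding) := by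
      rw [Finset.disjoint_left]
      intro z hz hz'
      obtain ⟨w, hw, rfl⟩ := Finset.mem_map.1 hz'
      have h1 := (memS w).1 hw
      have h2 := (memS _).1 hz
      simp only [Equiv.coe_toEmbedding, Equiv.neg_apply, neg_neg] at h2
      omega
    have hsub : S ∪ S.map (Equiv.neg (ZMod p)).toEmbedding ⊆ Finset.univ.erase 0 := by
      intro z hz
      refine Finset.mem_erase.2 ⟨?_, Finset.mem_univ _⟩
      rintro rfl
      have h0 : (0 : ZMod p) ∉ S := by simp [memS]
      simp [h0] at hz
    have := Finset.card_le_card hsub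
    rw [Finset.card_union_of_disjoint hdisj, Finset.card_map,
      Finset.card_erase_of_mem (Finset.mem_univ _), Finset.card_univ, ZMod.card] at this
    have := hp.pos
    rw [Fintype.card_coe]
    omega
  · intro z hz
    rcases memS_or hz with h | h
    · exact ⟨⟨z, h⟩, Or.inl rfl⟩
    · refine ⟨⟨-z / u, ?_⟩, Or.inr ?_⟩
      · rwa [← memS_mul, div_mul_cancel₀ _ hu0]
      · simp [hu0]
  · intro z hz
    obtain ⟨j, hj⟩ := cover hu2 hz
    refine ⟨j, hj.imp (fun h => ?_) fun h => ?_⟩ <;> rw [← h] <;> ring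
  · intro z hz
    obtain ⟨j, hj⟩ := cover hu1 hz
    refine ⟨j, hj.imp (fun h => ?_) fun h => ?_⟩ <;> rw [← h] <;> ring

theorem hasSkewCover_seventeen : HasSkewCover 17 :=
  ⟨Fin 8, inferInstance, ![1, 3, 4, 5, 7, 8, 10, 12], ![2, 9, 6, 13, 14, 11, 15, 16], by decide,
    by decide, by decide, by decide⟩

/-- Write `i = 4t`, a square root of `-1` modulo `16t² + 1`. The square
`{a + 1 + bi : 0 ≤ a, b < 2t}` meets each orbit of nonzero elements under multiplication
by `i`. -/
theorem exists_eq_rotate_square {t : ℕ} {z : ZMod (16 * t ^ 2 + 1)} (hz : z ≠ 0) :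
    ∃ a b : ℕ, a < 2 * t ∧ b < 2 * t ∧ ∃ q : ZMod (16 * t ^ 2 + 1), q = a + 1 + b * (4 * t) ∧
      (z = q ∨ z = -q ∨ z = 4 * t * q ∨ z = -(4 * t * q)) := by
  have hI : (4 * t : ZMod (16 * t ^ 2 + 1)) ^ 2 = -1 := by
    have h := ZMod.natCast_self (16 * t ^ 2 + 1)
    push_cast at h
    linear_combination h
  have small (Z : ℕ) (h1 : 1 ≤ Z) (h2 : Z ≤ 8 * t ^ 2) :
      ∃ a b : ℕ, a < 2 * t ∧ b < 2 * t ∧ ∃ q : ZMod (16 * t ^ 2 + 1), q = a + 1 + b * (4 * t) ∧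
        ((Z : ZMod (16 * t ^ 2 + 1)) = q ∨ (Z : ZMod (16 * t ^ 2 + 1)) = 4 * t * q) := by
    have ht : 0 < t := Nat.pos_of_ne_zero (by rintro rfl; omega)
    have hdm := Nat.mod_add_div (Z - 1) (4 * t)
    have hr := Nat.mod_lt (Z - 1) (by omega : 4 * t > 0)
    have hB : (Z - 1) / (4 * t) < 2 * t := by
      rw [Nat.div_lt_iff_lt_mul (by omega)]
      have : 2 * t * (4 * t) = 8 * t ^ 2 := by ring
      omega
    set r := (Z - 1) % (4 * t)
    set B := (Z - 1) / (4 * t)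
    have hZ : (Z : ZMod (16 * t ^ 2 + 1)) = r + 4 * t * B + 1 := by
      have : Z = r + 4 * t * B + 1 := by omega
      rw [this]
      push_cast
      ring
    by_cases h : r < 2 * t
    · exact ⟨r, B, h, hB, _, rfl, Or.inl (by rw [hZ]; ring)⟩
    · refine ⟨B, 4 * t - 1 - r, hB, by omega, _, rfl, Or.inr ?_⟩
      have hc : ((4 * t - 1 - r : ℕ) : ZMod (16 * t ^ 2 + 1)) = 4 * t - 1 - r := by
        rw [Nat.cast_sub (by omega), Nat.cast_sub (by omega)]
        push_cast
        ring
      rw [hZ, hc]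
      linear_combination -(4 * t - 1 - r : ZMod (16 * t ^ 2 + 1)) * hI
  have hval : z.val ≠ 0 := (ZMod.val_ne_zero z).2 hz
  have hlt := ZMod.val_lt z
  have hcast : ((z.val : ℕ) : ZMod (16 * t ^ 2 + 1)) = z := ZMod.natCast_rightInverse z
  by_cases h : z.val ≤ 8 * t ^ 2
  · obtain ⟨a, b, ha, hb, q, hq, hZ⟩ := small z.val (by omega) h
    rw [hcast] at hZ
    exact ⟨a, b, ha, hb, q, hq, by tauto⟩
  · obtain ⟨a, b, ha, hb, q, hq, hZ⟩ := small (16 * t ^ 2 + 1 - z.val) (by omega) (by omega)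
    rw [Nat.cast_sub hlt.le, hcast, ZMod.natCast_self, zero_sub, neg_eq_iff_eq_neg,
      neg_eq_iff_eq_neg] at hZ
    exact ⟨a, b, ha, hb, q, hq, by tauto⟩

namespace TorusPairs

variable {R : Type*} [CommRing R]

/-- The square `{a + 1 + bi : 0 ≤ a, b < 2t}` meets each orbit of nonzero elements under
multiplication by `i`. -/
def SquareMeetsOrbits (t : ℕ) (i : R) : Prop :=
  ∀ z : R, z ≠ 0 → ∃ a b : ℕ, a < 2 * t ∧ b < 2 * t ∧ ∃ q : R, q = a + 1 + b * i ∧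
    (z = q ∨ z = -q ∨ z = i * q ∨ z = -(i * q))

/-- First entry of the base pair of kind `k` at position `(a, b)`. -/
def fst (i : R) (k : Bool) (a b : ℕ) : R :=
  if k then a + 1 + b * i else -(a + 1 + b * i)

/-- Second entry of the base pair of kind `k` at position `(a, b)`. -/
def snd (t : ℕ) (i : R) (k : Bool) (a b : ℕ) : R :=
  if k then i * ((if a < t then (a : R) + t else (a : R) - t) + 1 + (b + t) * i)
  else i * (2 * t - a + (2 * t - 1 - b) * i)

/-- The sign given to the base pairs at height `b`. -/
def sgn (R : Type*) [CommRing R] (s b : ℕ) : R :=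
  if b < s then 1 else -1

/-- The multiplier `i` or `1`. -/
def rot (i : R) (r : Bool) : R :=
  if r then i else 1

/-- The signed and rotated family built from `D`. -/
def spread (s t : ℕ) (i : R) (D : Bool → ℕ → ℕ → R) (j : Bool × Bool × Fin (2 * t) × Fin t) : R :=
  rot i j.1 * (sgn R s j.2.2.2 * D j.2.1 j.2.2.1 j.2.2.2)

theorem sgn_eq_or (s b : ℕ) : sgn R s b = 1 ∨ sgn R s b = -1 := by
  by_cases h : b < s <;> simp [sgn, h]

theorem cast_eq_of_add_add_one {a b t : ℕ} (h : a + b + 1 = 2 * t) :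
    (a : R) + b + 1 = 2 * t := by
  exact_mod_cast congrArg (Nat.cast : ℕ → R) h

/-- If the values of `D` contain a representative of each orbit of the square scaled by a unit `c`,
then `±spread D` reaches all nonzero elements. -/
theorem exists_spread_eq {s t : ℕ} {i : R} (hi : i ^ 2 = -1) (hsq : SquareMeetsOrbits t i)
    {D : Bool → ℕ → ℕ → R} {c d : R} (hcd : c * d = 1)
    (hD : ∀ a b : ℕ, a < 2 * t → b < 2 * t → ∃ k a' b', a' < 2 * t ∧ b' < t ∧
      (D k a' b' = c * (a + 1 + b * i) ∨ D k a' b' = i * (c * (a + 1 + b * i)) ∨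
        D k a' b' = -(i * (c * (a + 1 + b * i))))) {z : R} (hz : z ≠ 0) :
    ∃ j, spread s t i D j = z ∨ -spread s t i D j = z := by
  obtain ⟨a, b, ha, hb, q, hq, hzq⟩ := hsq (d * z) fun h => hz (by
    linear_combination c * h - z * hcd)
  obtain ⟨k, a', b', ha', hb', hk⟩ := hD a b ha hb
  rw [← hq] at hk
  have hz' : z = c * (d * z) := by linear_combination -z * hcd
  have hDz : ∃ r : Bool, z = rot i r * D k a' b' ∨ z = -(rot i r * D k a' b') := by
    simp only [rot, Bool.exists_bool, Bool.false_eq_true, if_false, if_true]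
    generalize d * z = w at hz' hzq
    subst hz'
    rcases hk with hk | hk | hk <;> rw [hk] <;>
      rcases hzq with h | h | h | h <;> rw [h]
    · exact Or.inl (Or.inl (by ring))
    · exact Or.inl (Or.inr (by ring))
    · exact Or.inr (Or.inl (by ring))
    · exact Or.inr (Or.inr (by ring))
    · exact Or.inr (Or.inr (by linear_combination c * q * hi))
    · exact Or.inr (Or.inl (by linear_combination -c * q * hi))
    · exact Or.inl (Or.inl (by ring))
    · exact Or.inl (Or.inr (by ring))
    · exact Or.inr (Or.inl (by linear_combination c * q * hi))
    · exact Or.inr (Or.inr (by linear_combination -c * q * hi))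
    · exact Or.inl (Or.inr (by ring))
    · exact Or.inl (Or.inl (by ring))
  obtain ⟨r, hr⟩ := hDz
  refine ⟨(r, k, ⟨a', ha'⟩, ⟨b', hb'⟩), ?_⟩
  rcases sgn_eq_or (R := R) s b' with h | h <;> rcases hr with hr | hr <;> simp [spread, h, hr]

/-- Both signs of a point in the lower half of the square occur as first entries. -/
theorem exists_sgn_mul_fst (s : ℕ) (i : R) (a b : ℕ) {δ : R} (hδ : δ = 1 ∨ δ = -1) :
    ∃ k, sgn R s b * fst i k a b = δ * (a + 1 + b * i) := by
  simp only [fst, Bool.exists_bool, Bool.false_eq_true, if_false, if_true]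
  rcases sgn_eq_or (R := R) s b with h | h <;> rcases hδ with rfl | rfl <;> rw [h]
  · exact Or.inr rfl
  · exact Or.inl (by ring)
  · exact Or.inl (by ring)
  · exact Or.inr rfl

/-- Both signs of the `i`-multiple of a point in the upper half of the square occur as second
entries. -/
theorem exists_sgn_mul_snd {s t : ℕ} (ht : t = 2 * s) (i : R) {a b : ℕ} (ha : a < 2 * t)
    (hb : b < 2 * t) (hbt : t ≤ b) {δ : R} (hδ : δ = 1 ∨ δ = -1) :
    ∃ k a' b', a' < 2 * t ∧ b' < t ∧
      sgn R s b' * snd t i k a' b' = δ * (i * (a + 1 + b * i)) := by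
  obtain ⟨b₂, hb₂⟩ : ∃ b₂, b + b₂ + 1 = 2 * t := ⟨2 * t - 1 - b, by omega⟩
  obtain ⟨a₂, ha₂⟩ : ∃ a₂, a + a₂ + 1 = 2 * t := ⟨2 * t - 1 - a, by omega⟩
  have h₂ : snd t i false a₂ b₂ = i * (a + 1 + b * i) := by
    simp only [snd, Bool.false_eq_true, if_false]
    linear_combination -i ^ 2 * cast_eq_of_add_add_one (R := R) hb₂ -
      i * cast_eq_of_add_add_one (R := R) ha₂
  obtain ⟨b₁, rfl⟩ : ∃ b₁, b = b₁ + t := ⟨b - t, by omega⟩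
  have h₁ : ∃ a₁, a₁ < 2 * t ∧ snd t i true a₁ b₁ = i * (a + 1 + (b₁ + t : ℕ) * i) := by
    by_cases hat : a < t
    · refine ⟨a + t, by omega, ?_⟩
      simp only [snd, if_true]
      rw [if_neg (by omega)]
      push_cast
      ring
    · obtain ⟨a₁, rfl⟩ : ∃ a₁, a = a₁ + t := ⟨a - t, by omega⟩
      refine ⟨a₁, by omega, ?_⟩
      simp only [snd, if_true]
      rw [if_pos (by omega)]
      push_cast
      ring
  obtain ⟨a₁, ha₁, h₁⟩ := h₁
  have hsgn : sgn R s b₁ = -sgn R s b₂ := by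
    by_cases h : b₁ < s
    · simp [sgn, h, show ¬ b₂ < s by omega]
    · simp [sgn, h, show b₂ < s by omega]
  by_cases hδs : sgn R s b₁ = δ
  · exact ⟨true, a₁, b₁, ha₁, by omega, by rw [h₁, hδs]⟩
  · refine ⟨false, a₂, b₂, by omega, by omega, ?_⟩
    have : sgn R s b₂ = δ := by
      rcases sgn_eq_or (R := R) s b₂ with h | h <;> rcases hδ with rfl | rfl <;> simp_all
    rw [h₂, this]

theorem exists_entry_eq {s t : ℕ} (ht : t = 2 * s) {i : R} (hi : i ^ 2 = -1)
    (hsq : SquareMeetsOrbits t i) {z : R} (hz : z ≠ 0) :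
    ∃ j, spread s t i (fst i) j = z ∨ spread s t i (snd t i) j = z := by
  obtain ⟨a, b, ha, hb, q, hq, hzq⟩ := hsq z hz
  by_cases hbt : b < t
  · have key (r : Bool) (δ : R) (hδ : δ = 1 ∨ δ = -1) (h : z = rot i r * (δ * q)) :
        ∃ j, spread s t i (fst i) j = z ∨ spread s t i (snd t i) j = z := by
      obtain ⟨k, hk⟩ := exists_sgn_mul_fst s i a b hδ
      exact ⟨(r, k, ⟨a, ha⟩, ⟨b, hbt⟩), Or.inl (by rw [h, hq, ← hk]; rfl)⟩
    rcases hzq with h | h | h | h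
    · exact key false 1 (Or.inl rfl) (by simp [rot, h])
    · exact key false (-1) (Or.inr rfl) (by simp [rot, h])
    · exact key true 1 (Or.inl rfl) (by simp [rot, h])
    · exact key true (-1) (Or.inr rfl) (by simp [rot, h])
  · have key (r : Bool) (δ : R) (hδ : δ = 1 ∨ δ = -1) (h : z = rot i r * (δ * (i * q))) :
        ∃ j, spread s t i (fst i) j = z ∨ spread s t i (snd t i) j = z := by
      obtain ⟨k, a', b', ha', hb', hk⟩ := exists_sgn_mul_snd ht i ha hb (not_lt.1 hbt) hδ
      exact ⟨(r, k, ⟨a', ha'⟩, ⟨b', hb'⟩), Or.inr (by rw [h, hq, ← hk]; rfl)⟩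
    rcases hzq with h | h | h | h
    · exact key true (-1) (Or.inr rfl) (by
        simp only [rot, if_true, h]; linear_combination q * hi)
    · exact key true 1 (Or.inl rfl) (by
        simp only [rot, if_true, h]; linear_combination -q * hi)
    · exact key false 1 (Or.inl rfl) (by simp [rot, h])
    · exact key false (-1) (Or.inr rfl) (by simp [rot, h])

theorem exists_difference_eq {t : ℕ} {i : R} (hi : i ^ 2 = -1) {a b : ℕ} (ha : a < 2 * t)
    (hb : b < 2 * t) : ∃ k a' b', a' < 2 * t ∧ b' < t ∧
      (fst i k a' b' - snd t i k a' b' = (1 - i) * (a + 1 + b * i) ∨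
        fst i k a' b' - snd t i k a' b' = i * ((1 - i) * (a + 1 + b * i)) ∨
        fst i k a' b' - snd t i k a' b' = -(i * ((1 - i) * (a + 1 + b * i)))) := by
  by_cases hat : a < t
  · obtain ⟨a₁, ha₁⟩ : ∃ a₁, b + a₁ + 1 = 2 * t := ⟨2 * t - 1 - b, by omega⟩
    refine ⟨false, a₁, a, by omega, hat, Or.inr (Or.inr ?_)⟩
    simp only [fst, snd, Bool.false_eq_true, if_false]
    linear_combination (i - 1) * cast_eq_of_add_add_one (R := R) ha₁ +
      (b - 2 * t - b * i) * hi
  · obtain ⟨a₁, rfl⟩ : ∃ a₁, a = a₁ + t := ⟨a - t, by omega⟩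
    by_cases hbt : b < t
    · refine ⟨true, a₁, b, by omega, hbt, Or.inl ?_⟩
      simp only [fst, snd, if_true]
      rw [if_pos (by omega)]
      push_cast
      linear_combination -(t : R) * hi
    · obtain ⟨b₁, rfl⟩ : ∃ b₁, b = b₁ + t := ⟨b - t, by omega⟩
      refine ⟨true, a₁ + t, b₁, by omega, by omega, Or.inl ?_⟩
      simp only [fst, snd, if_true]
      rw [if_neg (by omega)]
      push_cast
      ring

theorem exists_sum_eq {t : ℕ} {i : R} (hi : i ^ 2 = -1) {a b : ℕ} (ha : a < 2 * t)
    (hb : b < 2 * t) : ∃ k a' b', a' < 2 * t ∧ b' < t ∧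
      (fst i k a' b' + snd t i k a' b' = (1 + i) * (a + 1 + b * i) ∨
        fst i k a' b' + snd t i k a' b' = i * ((1 + i) * (a + 1 + b * i)) ∨
        fst i k a' b' + snd t i k a' b' = -(i * ((1 + i) * (a + 1 + b * i)))) := by
  by_cases hat : a < t
  · by_cases hbt : b < t
    · refine ⟨true, a + t, b, by omega, hbt, Or.inl ?_⟩
      simp only [fst, snd, if_true]
      rw [if_neg (by omega)]
      push_cast
      linear_combination (t : R) * hi
    · obtain ⟨b₁, rfl⟩ : ∃ b₁, b = b₁ + t := ⟨b - t, by omega⟩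
      refine ⟨true, a, b₁, by omega, by omega, Or.inl ?_⟩
      simp only [fst, snd, if_true]
      rw [if_pos (by omega)]
      push_cast
      ring
  · obtain ⟨b₁, hb₁⟩ : ∃ b₁, a + b₁ + 1 = 2 * t := ⟨2 * t - 1 - a, by omega⟩
    refine ⟨false, b, b₁, hb, by omega, Or.inr (Or.inl ?_)⟩
    simp only [fst, snd, Bool.false_eq_true, if_false]
    linear_combination (1 - i) * cast_eq_of_add_add_one (R := R) hb₁ +
      (2 * t - 2 - b₁ - b - a - b * i) * hi

end TorusPairs

open TorusPairs in
/-- With `t = 2s` and `i = 4t`, there are two kinds of base pairs, for `0 ≤ a < 2t`, `0 ≤ b < t`: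
`-(a + 1 + bi)` with `i(2t - a + (2t - 1 - b)i)`, and `a + 1 + bi` with `i(a' + 1 + (b + t)i)`,
where `a' = a ± t`. Both are negated when `b ≥ s`, and all are taken together with their multiples
by `i`. -/
theorem hasSkewCover_sixtyFour_mul_sq_add_one (s : ℕ) : HasSkewCover (16 * (2 * s) ^ 2 + 1) := by
  obtain ⟨t, ht⟩ : ∃ t, t = 2 * s := ⟨_, rfl⟩
  rw [← ht]
  have hn : (16 * t ^ 2 + 1 : ZMod (16 * t ^ 2 + 1)) = 0 := by
    have h := ZMod.natCast_self (16 * t ^ 2 + 1)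
    push_cast at h
    exact h
  have hi : (4 * t : ZMod (16 * t ^ 2 + 1)) ^ 2 = -1 := by linear_combination hn
  have hsq : SquareMeetsOrbits t (4 * t : ZMod (16 * t ^ 2 + 1)) :=
    fun z hz => exists_eq_rotate_square hz
  refine ⟨Bool × Bool × Fin (2 * t) × Fin t, inferInstance, spread s t (4 * t) (fst (4 * t)),
    spread s t (4 * t) (snd t (4 * t)), ?_, fun z hz => exists_entry_eq ht hi hsq hz,
    fun z hz => ?_, fun z hz => ?_⟩
  · simp only [Fintype.card_prod, Fintype.card_bool, Fintype.card_fin]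
    nlinarith
  · refine (exists_spread_eq (s := s) hi hsq (d := (1 + 4 * t) * (-8 * t ^ 2))
      (by linear_combination (1 + 8 * (t : ZMod (16 * t ^ 2 + 1)) ^ 2) * hn - hn - hn)
      (fun a b ha hb => exists_difference_eq hi ha hb) hz).imp
      fun j hj => hj.imp (fun h => ?_) fun h => ?_ <;> rw [← h] <;> simp only [spread] <;> ring
  · refine (exists_spread_eq (s := s) hi hsq (d := (1 - 4 * t) * (-8 * t ^ 2))
      (by linear_combination (1 + 8 * (t : ZMod (16 * t ^ 2 + 1)) ^ 2) * hn - hn - hn)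
      (fun a b ha hb => exists_sum_eq hi ha hb) hz).imp
      fun j hj => hj.imp (fun h => ?_) fun h => ?_ <;> rw [← h] <;> simp only [spread] <;> ring

theorem Nat.Prime.hasSkewCover {p : ℕ} (hp : p.Prime) (h30 : Nat.Coprime p 30) :
    HasSkewCover p := by
  by_cases hq : ∃ q, q.Prime ∧ q ≠ 2 ∧ q ∣ p - 1
  · obtain ⟨q, hq, hq2, hqp⟩ := hq
    exact hasSkewCover_of_odd_prime_dvd hp hq hq2 hqp
  have hp2 := hp.two_le
  obtain ⟨k, hk⟩ : ∃ k, p - 1 = 2 ^ k := by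
    refine ⟨_, Nat.eq_prime_pow_of_unique_prime_dvd (by omega) fun {q} hq' hqp => ?_⟩
    by_contra hne
    exact hq ⟨q, hq', hne, hqp⟩
  have hpk : p = 2 ^ k + 1 := by omega
  have hne {r : ℕ} (hr : r ∣ 30) (hr1 : r ≠ 1) (hd : r ∣ p) : False :=
    hr1 (Nat.eq_one_of_dvd_coprimes h30 hd hr)
  obtain ⟨l, rfl | rfl⟩ := Nat.even_or_odd' k
  · obtain rfl | rfl | rfl | ⟨m, rfl⟩ : l = 0 ∨ l = 1 ∨ l = 2 ∨ ∃ m, l = m + 3 := by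
      by_cases h : l < 3
      · omega
      · exact Or.inr (Or.inr (Or.inr ⟨l - 3, by omega⟩))
    · exact (hne (r := 2) (by decide) (by decide) (by simp [hpk])).elim
    · exact (hne (r := 5) (by decide) (by decide) (by simp [hpk])).elim
    · exact hpk ▸ hasSkewCover_seventeen
    · have h64 : p = 16 * (2 * 2 ^ m) ^ 2 + 1 := by rw [hpk]; ring
      exact h64 ▸ hasSkewCover_sixtyFour_mul_sq_add_one _
  · refine (hne (r := 3) (by decide) (by decide) ?_).elim
    have h := Odd.nat_add_dvd_pow_add_pow 2 1 (odd_two_mul_add_one l)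
    simpa [hpk] using h

theorem hasSkewCover_of_coprime_thirty (n : ℕ) (h30 : Nat.Coprime n 30) : HasSkewCover n := by
  induction n using Nat.recOnMul with
  | zero => exact absurd h30 (by decide)
  | one => exact hasSkewCover_one
  | prime p hp => exact hp.hasSkewCover h30
  | mul a b iha ihb =>
    have hb := h30.coprime_mul_left
    exact (iha h30.coprime_mul_right).mul (ihb hb) (hb.coprime_dvd_right (by decide))

/-- If `gcd(n, 30) = 1` and `n > 1`, then there is a skew starter
in `ℤ_n`. -/
theorem stmt4 (n : ℕ) (hgcd : Nat.gcd n 30 = 1) (hn : 1 < n) :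
    ∃ (m : ℕ) (x y : Fin m → ZMod n),
      IsFrameStarter (⊥ : AddSubgroup (ZMod n)) x y ∧
        IsSkewFS (⊥ : AddSubgroup (ZMod n)) x y := by
  exact (hasSkewCover_of_coprime_thirty n hgcd).exists_skew_starter
end

section
/- Let g be odd and let h divide g, and suppose S = {{x_i,y_i} : 1 ≤ i ≤ (g−h)/2} is a cyclic strong frame starter of type h^{g/h} in Z_g. Then the sum over all pairs of (x_i + y_i)^2 is congruent to 0 modulo g (i.e., ∑_{i=1}^{(g−h)/2} (x_i+y_i)^2 = 0 in Z_g). -/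
/-- Summing over a family that covers the complement of `H` is summing over that complement. -/
theorem CoversComplement.sum_comp {G M : Type*} [AddCommGroup G] [Fintype G] [AddCommMonoid M]
    {H : AddSubgroup G} [DecidablePred (· ∈ H)] {m : ℕ} {f : Fin m ⊕ Fin m → G}
    (hf : CoversComplement H f) (φ : G → M) :
    ∑ i, φ (f i) = ∑ z with z ∉ H, φ z := by
  refine Finset.sum_bij (fun i _ => f i) (fun i _ => ?_) (fun i _ j _ hij => hf.1 hij)
    (fun z hz => ?_) (fun _ _ => rfl)
  · have : f i ∈ {z : G | z ∉ H} := hf.2 ▸ Set.mem_range_self i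
    simpa using this
  · have : z ∈ Set.range f := by rw [hf.2]; simpa using hz
    obtain ⟨i, rfl⟩ := this
    exact ⟨i, Finset.mem_univ i, rfl⟩

/-- Doubling permutes the complement of a subgroup of `ZMod g`, `g` odd, so the sum `T` of the
squares over the complement satisfies `4 * T = T`. -/
theorem ZMod.three_mul_sum_sq_notMem {g : ℕ} [NeZero g] (hodd : Odd g)
    (H : AddSubgroup (ZMod g)) [DecidablePred (· ∈ H)] :
    3 * ∑ z with z ∉ H, z ^ 2 = 0 := by
  obtain ⟨k, hk⟩ := hodd
  have hg : (2 * k + 1 : ZMod g) = 0 := by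
    have := ZMod.natCast_self g
    rw [hk] at this ⊢
    exact_mod_cast this
  have hmem (z : ZMod g) : 2 * z ∈ H ↔ z ∈ H := by
    refine ⟨fun hz => ?_, fun hz => by simpa [two_mul] using H.add_mem hz hz⟩
    have := H.nsmul_mem hz (k + 1)
    rw [nsmul_eq_mul] at this
    convert this using 1
    push_cast
    linear_combination -z * hg
  have key : ∑ z with z ∉ H, (2 * z) ^ 2 = ∑ z with z ∉ H, z ^ 2 := by
    refine Finset.sum_nbij' (fun z => 2 * z) (fun z => (k + 1) * z) ?_ ?_ ?_ ?_ (fun _ _ => rfl)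
    · intro z hz
      simpa [hmem] using hz
    · intro z hz
      have : 2 * ((k + 1) * z) = z := by linear_combination z * hg
      simpa [← hmem ((k + 1) * z), this] using hz
    · intro z _
      linear_combination z * hg
    · intro z _
      linear_combination z * hg
  simp only [mul_pow, ← Finset.mul_sum] at key
  linear_combination key

/-- If `(x, y)` is a cyclic strong frame starter of type `h^(g/h)`
in `ℤ_g` with `g = h * r` odd, then `∑ (x i + y i)^2 = 0` in `ℤ_g`. -/
theorem stmt5 (g h r : ℕ) (hg : g = h * r) (hodd : Odd g)
    (m : ℕ) (x y : Fin m → ZMod g)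
    (hS : IsFrameStarter (AddSubgroup.zmultiples (r : ZMod g)) x y)
    (hstrong : IsStrongFS (AddSubgroup.zmultiples (r : ZMod g)) x y) :
    ∑ i, (x i + y i) ^ 2 = 0 := by
  classical
  have : NeZero g := ⟨hodd.pos.ne'⟩
  have hxy := hS.1.sum_comp (· ^ 2)
  have hdiff := hS.2.sum_comp (· ^ 2)
  have hT := ZMod.three_mul_sum_sq_notMem hodd (AddSubgroup.zmultiples (r : ZMod g))
  rw [Fintype.sum_sum_type, ← Finset.sum_add_distrib] at hxy hdiff
  simp only [Sum.elim_inl, Sum.elim_inr] at hxy hdiff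
  have hunit : IsUnit (2 : ZMod g) := by
    exact_mod_cast (ZMod.isUnit_iff_coprime 2 g).2 (Nat.coprime_two_left.2 hodd)
  have hpar : 2 * ∑ i, (x i + y i) ^ 2 =
      4 * ∑ i, (x i ^ 2 + y i ^ 2) - ∑ i, ((x i - y i) ^ 2 + (y i - x i) ^ 2) := by
    rw [Finset.mul_sum, Finset.mul_sum, ← Finset.sum_sub_distrib]
    exact Finset.sum_congr rfl fun i _ => by ring
  rw [← hunit.mul_right_eq_zero, hpar, hxy, hdiff]
  linear_combination hT
end

section
/- Let g be odd and let h be a divisor of g. If (2gh−1)(g−h) ≢ 0 (mod 6h), then there is no cyclic skew frame starter of type h^{g/h} in Z_g. -/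
/-- A family covering `G \ H` turns sums over its index type into sums over `G \ H`. -/
theorem CoversComplement.sum_add_sum {G M : Type*} [AddCommGroup G] [Fintype G]
    [AddCommMonoid M] {H : AddSubgroup G} [DecidablePred (· ∈ H)] {m : ℕ} {u v : Fin m → G}
    (hf : CoversComplement H (Sum.elim u v)) (φ : G → M) :
    ∑ i, φ (u i) + ∑ i, φ (v i) = ∑ z with z ∉ H, φ z := by
  have key : ∑ s, φ (Sum.elim u v s) = ∑ z with z ∉ H, φ z := by
    refine Finset.sum_nbij (Sum.elim u v) ?_ hf.1.injOn ?_ fun _ _ => rfl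
    · intro s _
      have hs : Sum.elim u v s ∈ {z : G | z ∉ H} := hf.2 ▸ Set.mem_range_self s
      simpa using hs
    · intro z hz
      have hz' : z ∈ Set.range (Sum.elim u v) := by
        rw [hf.2]
        simpa using hz
      obtain ⟨s, rfl⟩ := hz'
      exact ⟨s, by simp, rfl⟩
  simpa [Fintype.sum_sum_type] using key

/-- Twice the sum of squares over the complement of `H` vanishes if there is a skew frame
starter in `R \ H`. -/
theorem two_mul_sum_sq_eq_zero_of_isSkewFS {R : Type*} [CommRing R] [Fintype R]
    {H : AddSubgroup R} [DecidablePred (· ∈ H)] {m : ℕ} {x y : Fin m → R}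
    (hfs : IsFrameStarter H x y) (hskew : IsSkewFS H x y) :
    2 * ∑ z with z ∉ H, z ^ 2 = 0 := by
  have entries := hfs.1.sum_add_sum (· ^ 2)
  have differences := hfs.2.sum_add_sum (· ^ 2)
  have sums := CoversComplement.sum_add_sum hskew (· ^ 2)
  have parallelogram :
      (∑ i, (x i - y i) ^ 2 + ∑ i, (y i - x i) ^ 2) +
        (∑ i, (x i + y i) ^ 2 + ∑ i, (-(x i + y i)) ^ 2) =
      4 * (∑ i, x i ^ 2 + ∑ i, y i ^ 2) := by
    simp only [← Finset.sum_add_distrib, Finset.mul_sum]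
    exact Finset.sum_congr rfl fun i _ => by ring
  rw [entries, differences, sums] at parallelogram
  linear_combination -parallelogram

theorem six_mul_sum_range_sq (n : ℕ) :
    6 * ∑ k ∈ Finset.range n, (k : ℤ) ^ 2 = n * (n - 1) * (2 * n - 1) := by
  induction n with
  | zero => simp
  | succ n ih =>
    rw [Finset.sum_range_succ, mul_add, ih]
    push_cast
    ring

theorem ZMod.sum_eq_sum_range {M : Type*} [AddCommMonoid M] (n : ℕ) [NeZero n]
    (φ : ZMod n → M) : ∑ z, φ z = ∑ k ∈ Finset.range n, φ k := by
  refine Finset.sum_nbij' ZMod.val (fun k => (k : ZMod n)) ?_ ?_ ?_ ?_ ?_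
  · simp [ZMod.val_lt]
  · simp
  · simp
  · intro k hk
    exact ZMod.val_cast_of_lt (Finset.mem_range.mp hk)
  · simp

theorem ZMod.sum_zmultiples_eq_sum_range {M : Type*} [AddCommMonoid M] (h r : ℕ)
    [NeZero (h * r)]
    [DecidablePred (· ∈ AddSubgroup.zmultiples (r : ZMod (h * r)))] (φ : ZMod (h * r) → M) :
    ∑ z with z ∈ AddSubgroup.zmultiples (r : ZMod (h * r)), φ z =
      ∑ j ∈ Finset.range h, φ (j * r : ℕ) := by
  have hne : h * r ≠ 0 := NeZero.ne _
  have hr : 0 < r := Nat.pos_of_ne_zero (right_ne_zero_of_mul hne)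
  have hh : 0 < h := Nat.pos_of_ne_zero (left_ne_zero_of_mul hne)
  symm
  refine Finset.sum_nbij (fun j : ℕ => ((j * r : ℕ) : ZMod (h * r))) ?_ ?_ ?_ fun _ _ => rfl
  · intro j _
    simp only [Finset.mem_filter, Finset.mem_univ, true_and]
    exact AddSubgroup.mem_zmultiples_iff.mpr ⟨j, by simp⟩
  · intro i hi j hj hij
    simp only [Finset.coe_range, Set.mem_Iio] at hi hj
    have hval := congrArg ZMod.val hij
    simp only at hval
    rw [ZMod.val_cast_of_lt (Nat.mul_lt_mul_of_pos_right hi hr),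
      ZMod.val_cast_of_lt (Nat.mul_lt_mul_of_pos_right hj hr)] at hval
    exact Nat.eq_of_mul_eq_mul_right hr hval
  · intro z hz
    simp only [Finset.coe_filter, Finset.mem_univ, true_and, Set.mem_ofPred_eq] at hz
    obtain ⟨k, rfl⟩ := AddSubgroup.mem_zmultiples_iff.mp hz
    have hh' : (0 : ℤ) < h := by exact_mod_cast hh
    obtain ⟨j, hj⟩ := Int.eq_ofNat_of_zero_le (Int.emod_nonneg k hh'.ne')
    have hjh : j < h := by
      have := Int.emod_lt_of_pos k hh'
      omega
    refine ⟨j, by simpa using hjh, ?_⟩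
    have hdiv := Int.emod_add_mul_ediv k h
    rw [hj] at hdiv
    have hzero : (h : ZMod (h * r)) * r = 0 := by
      exact_mod_cast ZMod.natCast_self (h * r)
    have hcast := congrArg (Int.cast : ℤ → ZMod (h * r)) hdiv
    push_cast at hcast
    simp only [zsmul_eq_mul]
    push_cast
    linear_combination (r : ZMod (h * r)) * hcast - ((k / h : ℤ) : ZMod (h * r)) * hzero

/-- If `g = h * r` is odd and `(2*g*h - 1) * (g - h) ≢ 0 (mod 6*h)`,
then there is no cyclic skew frame starter of type `h^(g/h)` in `ℤ_g`. -/
theorem stmt8 (g h r : ℕ) (hg : g = h * r) (hodd : Odd g)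
    (hnd : ¬ ((6 * (h : ℤ)) ∣ (2 * (g : ℤ) * (h : ℤ) - 1) * ((g : ℤ) - (h : ℤ)))) :
    ¬ ∃ (m : ℕ) (x y : Fin m → ZMod g),
      IsFrameStarter (AddSubgroup.zmultiples (r : ZMod g)) x y ∧
        IsSkewFS (AddSubgroup.zmultiples (r : ZMod g)) x y := by
  classical
  rintro ⟨m, x, y, hfs, hskew⟩
  subst hg
  have : NeZero (h * r) := ⟨hodd.pos.ne'⟩
  have htwice := two_mul_sum_sq_eq_zero_of_isSkewFS hfs hskew
  have hsplit := Finset.sum_filter_add_sum_filter_not Finset.univ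
    (· ∈ AddSubgroup.zmultiples (r : ZMod (h * r))) (· ^ 2)
  rw [ZMod.sum_zmultiples_eq_sum_range, ZMod.sum_eq_sum_range] at hsplit
  have hdvd : ((h * r : ℕ) : ℤ) ∣ 2 * (∑ k ∈ Finset.range (h * r), (k : ℤ) ^ 2 -
      r ^ 2 * ∑ j ∈ Finset.range h, (j : ℤ) ^ 2) := by
    rw [← ZMod.intCast_zmod_eq_zero_iff_dvd]
    simp only [Nat.cast_mul, mul_pow, ← Finset.sum_mul] at hsplit
    push_cast
    linear_combination htwice - 2 * hsplit
  have hcop : IsCoprime ((h * r : ℕ) : ℤ) 2 := by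
    exact_mod_cast Nat.isCoprime_iff_coprime.mpr hodd.coprime_two_right
  obtain ⟨t, ht⟩ := hcop.dvd_of_dvd_mul_left hdvd
  have hG := six_mul_sum_range_sq (h * r)
  have hH := six_mul_sum_range_sq h
  have hr : (r : ℤ) ≠ 0 := by exact_mod_cast right_ne_zero_of_mul hodd.pos.ne'
  refine hnd ⟨t, mul_left_cancel₀ hr ?_⟩
  push_cast at *
  linear_combination 6 * ht - hG + (r : ℤ) ^ 2 * hH
end

section
/- If t is a positive integer with t ≢ 0 (mod 3), then there does not exist a cyclic skew frame starter of type 2^{3t} in Z_{6t}, and there does not exist a cyclic skew frame starter of type 4^{3t} in Z_{12t}. -/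
/-- Summing a function that vanishes on `H` along a family covering `G \\ H` gives its
sum over `G`. -/
theorem CoversComplement.sum_eq {G M : Type*} [AddCommGroup G] [Fintype G] [AddCommMonoid M]
    {H : AddSubgroup G} {m : ℕ} {f : Fin m ⊕ Fin m → G} (hf : CoversComplement H f)
    (F : G → M) (hF : ∀ z ∈ H, F z = 0) : ∑ j, F (f j) = ∑ z, F z := by
  refine Fintype.sum_of_injective f hf.1 _ _ (fun z hz => hF z ?_) fun _ => rfl
  rw [hf.2] at hz
  simpa using hz

/-- A skew frame starter forces the squares of any `ZMod 3`-valued character that is trivial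
on `H` to sum to zero. -/
theorem sum_sq_eq_zero_of_skew {G : Type*} [AddCommGroup G] [Fintype G] {H : AddSubgroup G}
    {m : ℕ} {x y : Fin m → G} (hS : IsFrameStarter H x y) (hskew : IsSkewFS H x y)
    (φ : G →+ ZMod 3) (hφ : ∀ z ∈ H, φ z = 0) : ∑ z, φ z ^ 2 = 0 := by
  have hF : ∀ z ∈ H, φ z ^ 2 = 0 := fun z hz => by simp [hφ z hz]
  have entries := hS.1.sum_eq (fun z => φ z ^ 2) hF
  have differences := hS.2.sum_eq (fun z => φ z ^ 2) hF
  have sums := CoversComplement.sum_eq hskew (fun z => φ z ^ 2) hF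
  simp only [Fintype.sum_sum_type, Sum.elim_inl, Sum.elim_inr, map_sub, map_add, map_neg,
    ← Finset.sum_add_distrib] at entries differences sums
  have parallelogram : ∑ i, ((φ (x i) - φ (y i)) ^ 2 + (φ (y i) - φ (x i)) ^ 2) +
      ∑ i, ((φ (x i) + φ (y i)) ^ 2 + (-(φ (x i) + φ (y i))) ^ 2) =
      4 * ∑ i, (φ (x i) ^ 2 + φ (y i) ^ 2) := by
    rw [← Finset.sum_add_distrib, Finset.mul_sum]
    exact Finset.sum_congr rfl fun i _ => by ring
  rw [entries, differences, sums] at parallelogram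
  generalize ∑ z, φ z ^ 2 = q at parallelogram
  revert q
  decide

theorem sum_range_three_mul_sq (k : ℕ) :
    ∑ i ∈ Finset.range (3 * k), (i : ZMod 3) ^ 2 = 2 * k := by
  have three : (3 : ZMod 3) = 0 := rfl
  induction k with
  | zero => simp
  | succ k ih =>
    rw [Nat.mul_succ, Finset.sum_range_succ, Finset.sum_range_succ, Finset.sum_range_succ, ih]
    push_cast
    rw [three]
    ring_nf
    rw [show (5 : ZMod 3) = 2 from rfl]

theorem sum_castHom_sq (k : ℕ) [NeZero (3 * k)] :
    ∑ z : ZMod (3 * k), ZMod.castHom (dvd_mul_right 3 k) (ZMod 3) z ^ 2 = 2 * k := by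
  rw [← sum_range_three_mul_sq]
  refine Finset.sum_bij (fun z _ => z.val) (fun z _ => Finset.mem_range.2 z.val_lt)
    (fun a _ b _ h => ZMod.val_injective _ h) (fun b hb => ⟨b, Finset.mem_univ _,
      ZMod.val_cast_of_lt (Finset.mem_range.1 hb)⟩) fun z _ => ?_
  rw [ZMod.castHom_apply, ZMod.cast_eq_val]

theorem not_exists_skew_frameStarter_three_mul {k : ℕ} (hk : ¬ 3 ∣ k) (t : ℕ) :
    ¬ ∃ (m : ℕ) (x y : Fin m → ZMod (3 * k)),
      IsFrameStarter (AddSubgroup.zmultiples ((3 * t : ℕ) : ZMod (3 * k))) x y ∧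
        IsSkewFS (AddSubgroup.zmultiples ((3 * t : ℕ) : ZMod (3 * k))) x y := by
  rintro ⟨m, x, y, hS, hskew⟩
  have : NeZero (3 * k) := ⟨by rintro h; exact hk (by simp_all)⟩
  have h := sum_sq_eq_zero_of_skew hS hskew
    (ZMod.castHom (dvd_mul_right 3 k) (ZMod 3)).toAddMonoidHom (by
      rintro _ ⟨n, rfl⟩
      have hgen : ZMod.castHom (dvd_mul_right 3 k) (ZMod 3) ((3 * t : ℕ) : ZMod (3 * k)) = 0 := by
        rw [map_natCast, ZMod.natCast_eq_zero_iff]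
        exact dvd_mul_right 3 t
      exact (map_zsmul (ZMod.castHom (dvd_mul_right 3 k) (ZMod 3)) n _).trans
        (by rw [hgen, smul_zero]))
  have h' : ((2 * k : ℕ) : ZMod 3) = 0 := by
    push_cast
    rw [← sum_castHom_sq]
    exact h
  rw [ZMod.natCast_eq_zero_iff] at h'
  omega

/-- If `t ≢ 0 (mod 3)`, then there is no cyclic skew frame starter
of type `2^(3t)` in `ℤ_{6t}` (with `H = {0, 3t}`), and there is no cyclic skew
frame starter of type `4^(3t)` in `ℤ_{12t}` (with `H = {0, 3t, 6t, 9t}`). -/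
theorem stmt14 (t : ℕ) (ht : 0 < t) (hmod : ¬ 3 ∣ t) :
    (¬ ∃ (m : ℕ) (x y : Fin m → ZMod (6 * t)),
      IsFrameStarter (AddSubgroup.zmultiples ((3 * t : ℕ) : ZMod (6 * t))) x y ∧
        IsSkewFS (AddSubgroup.zmultiples ((3 * t : ℕ) : ZMod (6 * t))) x y) ∧
    (¬ ∃ (m : ℕ) (x y : Fin m → ZMod (12 * t)),
      IsFrameStarter (AddSubgroup.zmultiples ((3 * t : ℕ) : ZMod (12 * t))) x y ∧
        IsSkewFS (AddSubgroup.zmultiples ((3 * t : ℕ) : ZMod (12 * t))) x y) := by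
  constructor
  · rw [show 6 * t = 3 * (2 * t) by ring]
    exact not_exists_skew_frameStarter_three_mul (by omega) t
  · rw [show 12 * t = 3 * (4 * t) by ring]
    exact not_exists_skew_frameStarter_three_mul (by omega) t
end
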